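/- Let k be a field, let R be a (not necessarily commutative) noetherian k-algebra (so k maps into the center of R), let M and N be finitely generated R-modules, and let k' be a field extension of k. Then for every i ≥ 0 there is an isomorphism of k'-vector spaces Ext^i_{R ⊗_k k'}(M ⊗_k k', N ⊗_k k') ≅ Ext^i_R(M, N) ⊗_k k'. -/

import Mathlib

open CategoryTheory TensorProduct

namespace ExtBC
noncomputable section

section Res
variable {R : Type} [Ring R]

lemma exists_cover (Z : ModuleCat.{0} R) : ∃ (ι : Type) (p : ModuleCat.of R (ι →₀ R) ⟶ Z), Epi p ∧
    (Module.Finite R Z → Finite ι) := by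
  by_cases h : Module.Finite R Z
  · obtain ⟨n, f, hf⟩ := Module.Finite.exists_fin' R Z
    refine ⟨Fin n, ModuleCat.ofHom (f ∘ₗ (Finsupp.linearEquivFunOnFinite R R (Fin n)).toLinearMap),
      ?_, fun _ => inferInstance⟩
    rw [ModuleCat.epi_iff_surjective]
    exact hf.comp (Finsupp.linearEquivFunOnFinite R R (Fin n)).surjective
  · refine ⟨Z, ModuleCat.ofHom (Finsupp.linearCombination R id), ?_, fun h' => absurd h' h⟩
    rw [ModuleCat.epi_iff_surjective]
    exact Finsupp.linearCombination_id_surjective R Z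

def cIdx (Z : ModuleCat.{0} R) : Type := (exists_cover Z).choose
abbrev cover (Z : ModuleCat.{0} R) : ModuleCat.{0} R := ModuleCat.of R (cIdx Z →₀ R)
def cπ (Z : ModuleCat.{0} R) : cover Z ⟶ Z := (exists_cover Z).choose_spec.choose
instance (Z : ModuleCat.{0} R) : Epi (cπ Z) := (exists_cover Z).choose_spec.choose_spec.1
lemma cIdx_finite (Z : ModuleCat.{0} R) [Module.Finite R Z] : Finite (cIdx Z) :=
  (exists_cover Z).choose_spec.choose_spec.2 inferInstance

instance (Z : ModuleCat.{0} R) : Projective (cover Z) :=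
  ModuleCat.projective_of_free (Finsupp.basisSingleOne)

abbrev syz {X Y : ModuleCat.{0} R} (f : X ⟶ Y) : ModuleCat.{0} R :=
  cover (ModuleCat.of R (LinearMap.ker f.hom))

def dd {X Y : ModuleCat.{0} R} (f : X ⟶ Y) : syz f ⟶ X :=
  cπ _ ≫ ModuleCat.ofHom (LinearMap.ker f.hom).subtype

@[simp] lemma dd_comp {X Y : ModuleCat.{0} R} (f : X ⟶ Y) : dd f ≫ f = 0 := by
  rw [dd, Category.assoc]
  convert Limits.comp_zero
  ext x
  exact x.2

lemma dd_exact {X Y : ModuleCat.{0} R} (f : X ⟶ Y) :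
    (ShortComplex.mk (dd f) f (dd_comp f)).Exact := by
  rw [ShortComplex.moduleCat_exact_iff]
  intro x hx
  obtain ⟨y, hy⟩ := (ModuleCat.epi_iff_surjective (cπ (ModuleCat.of R (LinearMap.ker f.hom)))).1
    inferInstance ⟨x, hx⟩
  refine ⟨y, ?_⟩
  change ((cπ (ModuleCat.of R (LinearMap.ker f.hom))) y).1 = x
  rw [hy]

variable (Z : ModuleCat.{0} R)

/-- the successive syzygy morphisms -/
def sq : ℕ → Arrow (ModuleCat.{0} R)
  | 0 => Arrow.mk (cπ Z)
  | n + 1 => Arrow.mk (dd (sq n).hom)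

def sX (n : ℕ) : ModuleCat.{0} R := (sq Z n).left

def sd (n : ℕ) : sX Z (n + 1) ⟶ sX Z n := dd (sq Z n).hom

def se : sX Z 0 ⟶ Z := cπ Z

instance : Epi (se Z) := inferInstanceAs (Epi (cπ Z))

lemma sd_comp (n : ℕ) : sd Z (n + 1) ≫ sd Z n = 0 := dd_comp (sd Z n)

lemma sd_exact (n : ℕ) : (ShortComplex.mk (sd Z (n + 1)) (sd Z n) (sd_comp Z n)).Exact :=
  dd_exact (sd Z n)

lemma se_comp : sd Z 0 ≫ se Z = 0 := dd_comp (cπ Z)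

lemma se_exact : (ShortComplex.mk (sd Z 0) (se Z) (se_comp Z)).Exact :=
  dd_exact (cπ Z)

def cpx : ChainComplex (ModuleCat.{0} R) ℕ := ChainComplex.of (sX Z) (sd Z) (sd_comp Z)

lemma cpx_d (n : ℕ) : (cpx Z).d (n + 1) n = sd Z n := ChainComplex.of_d ..

lemma cpx_exactAt_succ (n : ℕ) : (cpx Z).ExactAt (n + 1) := by
  rw [HomologicalComplex.exactAt_iff' _ (n + 1 + 1) (n + 1) n (by simp) (by simp)]
  refine (ShortComplex.exact_iff_of_iso ?_).1 (sd_exact Z n)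
  exact ShortComplex.isoMk (Iso.refl (sX Z (n + 2))) (Iso.refl (sX Z (n + 1))) (Iso.refl (sX Z n))
    ((Category.id_comp _).trans ((cpx_d Z (n+1)).trans (Category.comp_id _).symm))
    ((Category.id_comp _).trans ((cpx_d Z n).trans (Category.comp_id _).symm))

lemma sX_eq (n : ℕ) : ∃ W, sX Z n = cover W ∧ (IsNoetherianRing R → Module.Finite R Z →
     Module.Finite R W) := by
  induction n with
  | zero => exact ⟨_, rfl, fun _ h => h⟩
  | succ n ih =>
    obtain ⟨W, hW, hf⟩ := ih
    have key : ∃ (Y : ModuleCat.{0} R) (f : sX Z n ⟶ Y), sX Z (n+1) = syz f :=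
      ⟨_, (sq Z n).hom, rfl⟩
    obtain ⟨Y, f, h⟩ := key
    refine ⟨_, h, fun h1 h2 => ?_⟩
    have := hf h1 h2
    have := cIdx_finite W
    have : Module.Finite R (sX Z n) := by rw [hW]; infer_instance
    have : IsNoetherian R (sX Z n) := isNoetherian_of_isNoetherianRing_of_finite R _
    infer_instance

lemma cpx_X_projective (n : ℕ) : Projective ((cpx Z).X n) := by
  obtain ⟨W, hW, -⟩ := sX_eq Z n
  change Projective (sX Z n)
  rw [hW]; infer_instance

lemma cpx_basis [IsNoetherianRing R] [Module.Finite R Z] (n : ℕ) :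
    ∃ (ι : Type) (_ : Finite ι), Nonempty (Module.Basis ι R ((cpx Z).X n)) := by
  obtain ⟨W, hW, hf⟩ := sX_eq Z n
  have := hf inferInstance inferInstance
  refine ⟨cIdx W, cIdx_finite W, ?_⟩
  change Nonempty (Module.Basis (cIdx W) R (sX Z n))
  rw [hW]
  exact ⟨Finsupp.basisSingleOne⟩

def cpxπ : cpx Z ⟶ (ChainComplex.single₀ (ModuleCat.{0} R)).obj Z :=
  (ChainComplex.toSingle₀Equiv _ _).symm
    ⟨se Z, (congrArg (fun f => CategoryStruct.comp f (se Z)) (cpx_d Z 0)).trans (se_comp Z)⟩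

lemma cpxπ_f : (cpxπ Z).f 0 = se Z := ChainComplex.toSingle₀Equiv_symm_apply_f_zero ..

lemma cpxπ_quasiIso : QuasiIso (cpxπ Z) := ⟨fun n => by
    cases n
    · rw [ChainComplex.quasiIsoAt₀_iff, ShortComplex.quasiIso_iff_of_zeros']
      · refine (ShortComplex.exact_and_epi_g_iff_of_iso ?_).2
          ⟨se_exact Z, inferInstanceAs (Epi (se Z))⟩
        exact ShortComplex.isoMk (Iso.refl (sX Z 1)) (Iso.refl (sX Z 0)) (Iso.refl Z)
          ((Category.id_comp _).trans ((cpx_d Z 0).symm.trans (Category.comp_id _).symm))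
          ((Category.id_comp _).trans ((cpxπ_f Z).symm.trans (Category.comp_id _).symm))
      all_goals rfl
    · rw [quasiIsoAt_iff_exactAt']
      · apply cpx_exactAt_succ
      · apply ChainComplex.exactAt_succ_single_obj⟩

def res : ProjectiveResolution Z where
  complex := cpx Z
  projective := cpx_X_projective Z
  π := cpxπ Z
  quasiIso := cpxπ_quasiIso Z

end Res

section BC
variable (k : Type) [Field k] (k' : Type) [Field k'] [Algebra k k']
    (R : Type) [Ring R] [Algebra k R]

open scoped ModuleCat

section carrier
variable (X : Type) [AddCommGroup X] [Module k X] [Module R X] [IsScalarTower k R X]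

def bact : k' ⊗[k] R →ₐ[k'] Module.End k' (k' ⊗[k] X) :=
  Algebra.TensorProduct.lift (Algebra.ofId k' _)
    ((Module.End.baseChangeHom k k' X).comp (Algebra.lsmul k k X))
    (fun c _ => Algebra.commutes c _)

/-- the base change of the module `X` -/
def Bc : Type := k' ⊗[k] X

instance : AddCommGroup (Bc k k' X) := inferInstanceAs (AddCommGroup (k' ⊗[k] X))
instance : Module k' (Bc k k' X) := inferInstanceAs (Module k' (k' ⊗[k] X))
instance : Module k (Bc k k' X) := inferInstanceAs (Module k (k' ⊗[k] X))
instance : IsScalarTower k k' (Bc k k' X) := inferInstanceAs (IsScalarTower k k' (k' ⊗[k] X))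

instance : Module (k' ⊗[k] R) (Bc k k' X) := 
  letI : Module (Module.End k' (k' ⊗[k] X)) (Bc k k' X) := 
    inferInstanceAs (Module (Module.End k' (k' ⊗[k] X)) (k' ⊗[k] X))
  Module.compHom (Bc k k' X) (bact k k' R X).toRingHom

variable {k X}
def bt (c : k') (x : X) : Bc k k' X := (c ⊗ₜ[k] x : k' ⊗[k] X)
variable {R k'}
lemma smul_bt (c d : k') (r : R) (x : X) :
    (c ⊗ₜ[k] r : k' ⊗[k] R) • bt (k := k) k' d x = bt k' (c * d) (r • x) := by
  change bact k k' R X (c ⊗ₜ r) (d ⊗ₜ x) = _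
  simp [bact, bt]
  rfl

lemma smul_bt' (c d : k') (x : X) :
    c • bt (k := k) k' d x = bt k' (c * d) x := rfl

@[elab_as_elim]
lemma Bc.ind {p : Bc k k' X → Prop} (x : Bc k k' X) (h0 : p 0) (h1 : ∀ c x, p (bt k' c x))
    (h2 : ∀ x y, p x → p y → p (x + y)) : p x :=
  TensorProduct.induction_on (motive := p) x h0 h1 h2

instance : IsScalarTower k' (k' ⊗[k] R) (Bc k k' X) where
  smul_assoc c s x := by
    change bact k k' R X (c • s) x = c • bact k k' R X s x
    rw [map_smul]; rfl


section ext
variable {Y : Type} [AddCommGroup Y] [Module (k' ⊗[k] R) Y]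

/-- the underlying additive map -/
def bextAux (g : X →+ Y) (hg : ∀ (r : R) x, g (r • x) = ((1 : k') ⊗ₜ[k] r : k' ⊗[k] R) • g x) :
    Bc k k' X →+ Y :=
  TensorProduct.liftAddHom (R := k) (M := k') (N := X)
    (AddMonoidHom.mk' (fun c => AddMonoidHom.mk' (fun x => (c ⊗ₜ[k] (1 : R) : k' ⊗[k] R) • g x)
      (by intro a b; simp)) (by
        intro a b; ext x; simp [TensorProduct.add_tmul, add_smul]))
    (by
      intro a c x
      simp only [AddMonoidHom.mk'_apply]
      rw [← algebraMap_smul R a x, hg, ← mul_smul, Algebra.TensorProduct.tmul_mul_tmul,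
        mul_one, one_mul, Algebra.algebraMap_eq_smul_one, TensorProduct.tmul_smul,
        TensorProduct.smul_tmul'])

lemma bextAux_bt (g : X →+ Y) (hg) (c : k') (x : X) :
    bextAux (R := R) g hg (bt (k := k) k' c x) = (c ⊗ₜ[k] (1 : R) : k' ⊗[k] R) • g x := rfl

def bext (g : X →+ Y) (hg : ∀ (r : R) x, g (r • x) = ((1 : k') ⊗ₜ[k] r : k' ⊗[k] R) • g x) :
    Bc k k' X →ₗ[k' ⊗[k] R] Y :=
  { bextAux g hg with
    map_smul' := by
      intro s x
      change bextAux g hg (s • x) = s • bextAux g hg x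
      induction s using TensorProduct.induction_on with
      | zero => simp
      | add s t hs ht => simp only [add_smul, map_add, hs, ht]
      | tmul c r =>
        refine Bc.ind x ?_ ?_ ?_
        · simp
        · intro d x
          rw [smul_bt, bextAux_bt, bextAux_bt, hg, ← mul_smul, ← mul_smul]
          simp
        · intro x y hx hy
          rw [smul_add, map_add, map_add, smul_add, hx, hy] }

lemma bext_bt (g : X →+ Y) (hg) (c : k') (x : X) :
    bext (R := R) g hg (bt (k := k) k' c x) = (c ⊗ₜ[k] (1 : R) : k' ⊗[k] R) • g x := rfl

lemma bhom_ext {f g : Bc k k' X →ₗ[k' ⊗[k] R] Y} (h : ∀ x, f (bt k' 1 x) = g (bt k' 1 x)) :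
    f = g := by
  ext x
  refine Bc.ind x (by simp) ?_ ?_
  · intro c x
    have : bt (k := k) k' c x = (c ⊗ₜ[k] (1 : R) : k' ⊗[k] R) • bt (k := k) k' 1 x := by
      rw [smul_bt]; simp
    rw [this, map_smul, map_smul, h]
  · intro x y hx hy
    rw [map_add, map_add, hx, hy]
end ext

variable {Y : Type} [AddCommGroup Y] [Module k Y] [Module R Y] [IsScalarTower k R Y]

variable (k k') in
def bmap (f : X →ₗ[R] Y) : Bc k k' X →ₗ[k' ⊗[k] R] Bc k k' Y :=
  bext (AddMonoidHom.mk' (fun x => bt k' 1 (f x)) (by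
      intro a b; rw [map_add]; exact TensorProduct.tmul_add _ _ _))
    (by intro r x; simp [smul_bt])

@[simp] lemma bmap_bt (f : X →ₗ[R] Y) (c : k') (x : X) :
    bmap k k' f (bt (k := k) k' c x) = bt k' c (f x) := by
  rw [bmap, bext_bt, AddMonoidHom.mk'_apply, smul_bt]; simp

lemma bmap_eq (f : X →ₗ[R] Y) (z : Bc k k' X) :
    bmap k k' f z = LinearMap.lTensor k' (f.restrictScalars k) z := by
  refine Bc.ind z (by simp; rfl) ?_ ?_
  · intro c x
    rw [bmap_bt]; rfl
  · intro x y hx hy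
    rw [map_add, hx, hy]
    exact (map_add (LinearMap.lTensor k' (f.restrictScalars k)) _ _).symm

lemma bt_add (c : k') (x y : X) : bt (k := k) k' c (x + y) = bt k' c x + bt k' c y :=
  TensorProduct.tmul_add _ _ _

lemma bmap_id : bmap k k' (LinearMap.id : X →ₗ[R] X) = LinearMap.id :=
  bhom_ext (fun x => by simp)

lemma bmap_add (f g : X →ₗ[R] Y) : bmap k k' (f + g) = bmap k k' f + bmap k k' g :=
  bhom_ext (fun x => by simp [bt_add])

lemma bmap_comp {W : Type} [AddCommGroup W] [Module k W] [Module R W] [IsScalarTower k R W]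
    (g : Y →ₗ[R] W) (f : X →ₗ[R] Y) : bmap k k' (g ∘ₗ f) = bmap k k' g ∘ₗ bmap k k' f :=
  bhom_ext (fun x => by simp)

lemma bmap_exact {W : Type} [AddCommGroup W] [Module k W] [Module R W] [IsScalarTower k R W]
    (f : X →ₗ[R] Y) (g : Y →ₗ[R] W) (h : Function.Exact f g) :
    Function.Exact (bmap k k' f) (bmap k k' g) := by
  have := Module.Flat.lTensor_exact k' (f := f.restrictScalars k)
    (g := g.restrictScalars k) h
  intro y
  rw [bmap_eq]
  refine (this y).trans ?_
  simp only [Set.mem_range, bmap_eq]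
  rfl

end carrier

def B : ModuleCat.{0} R ⥤ ModuleCat.{0} (k' ⊗[k] R) where
  obj X := ModuleCat.of _ (Bc k k' X)
  map f := ModuleCat.ofHom (bmap k k' f.hom)
  map_id _ := congrArg ModuleCat.ofHom bmap_id
  map_comp f g := congrArg ModuleCat.ofHom (bmap_comp g.hom f.hom)

instance : (B k k' R).Additive where
  map_add {_ _ f g} := congrArg ModuleCat.ofHom (bmap_add f.hom g.hom)

instance : (B k k' R).PreservesHomology := by
  apply Functor.preservesHomology_of_map_exact
  intro S hS
  rw [ShortComplex.ShortExact.moduleCat_exact_iff_function_exact] at hS ⊢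
  exact bmap_exact S.f.hom S.g.hom hS

instance : (B k k' R).PreservesProjectiveObjects where
  projective_obj {X} hX := ⟨by
    intro Z Y f e he
    let j : R →+* k' ⊗[k] R := (Algebra.TensorProduct.includeRight : R →ₐ[k] k' ⊗[k] R).toRingHom
    let f' : Bc k k' X →ₗ[k' ⊗[k] R] Y := f.hom
    let g : X ⟶ (ModuleCat.restrictScalars j).obj Y := ModuleCat.ofHom
      (Y := (ModuleCat.restrictScalars j).obj Y)
      { toFun := fun x => f' (bt k' 1 x)
        map_add' := fun a b => (congrArg f' (bt_add _ _ _)).trans (map_add f' _ _)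
        map_smul' := fun r x => by
          refine Eq.trans ?_ (map_smul f' ((1 : k') ⊗ₜ[k] r : k' ⊗[k] R) (bt k' 1 x))
          rw [smul_bt, mul_one] }
    have : Epi ((ModuleCat.restrictScalars j).map e) := by
      rw [ModuleCat.epi_iff_surjective] at he ⊢
      exact he
    let h := Projective.factorThru g ((ModuleCat.restrictScalars j).map e)
    have hh : h ≫ (ModuleCat.restrictScalars j).map e = g := Projective.factorThru_comp _ _
    refine ⟨ModuleCat.ofHom (bext (AddMonoidHom.mk' (fun x => (h.hom x : Z)) (fun a b =>
      map_add h.hom a b)) (fun r x => map_smul h.hom r x)), ?_⟩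
    ext1
    apply bhom_ext
    intro x
    have := congrArg (fun t => t.hom x) hh
    refine Eq.trans ?_ this
    change e.hom ((((1 : k') ⊗ₜ[k] (1 : R)) : k' ⊗[k] R) • (h.hom x : Z)) = e.hom (h.hom x)
    congr 1
    exact one_smul _ _⟩

/-- base change of vector spaces -/
def T : ModuleCat.{0} k ⥤ ModuleCat.{0} k' where
  obj X := ModuleCat.of _ (k' ⊗[k] X)
  map f := ModuleCat.ofHom (f.hom.baseChange k')
  map_id _ := by ext1; simp
  map_comp f g := by ext1; simp [LinearMap.baseChange_comp]

instance : (T k k').Additive where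
  map_add {X Y f g} := by
    exact congrArg ModuleCat.ofHom (LinearMap.baseChange_add f.hom g.hom)

instance : (T k k').PreservesHomology := by
  apply Functor.preservesHomology_of_map_exact
  intro S hS
  rw [ShortComplex.ShortExact.moduleCat_exact_iff_function_exact] at hS ⊢
  exact Module.Flat.lTensor_exact k' (f := S.f.hom) (g := S.g.hom) hS


variable {R} (N X : ModuleCat.{0} R)

lemma B_hom_smul {V W : ModuleCat.{0} (k' ⊗[k] R)} (c : k') (f : V ⟶ W) (v : V) :
    (c • f).hom v = (c ⊗ₜ[k] (1 : R) : k' ⊗[k] R) • f.hom v := by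
  have : algebraMap k' (k' ⊗[k] R) c = c ⊗ₜ[k] (1 : R) := rfl
  rw [← this]
  rfl

lemma B_smul_map {X N : ModuleCat.{0} R} (c d : k') (f : X ⟶ N) (x : X) :
    (c • (B k k' R).map f).hom (bt k' d x) = bt (k := k) k' (c * d) (f.hom x) := by
  refine (B_hom_smul k k' c ((B k k' R).map f) (bt k' d x)).trans ?_
  have h1 : ((B k k' R).map f).hom (bt k' d x) = bt (k := k) k' d (f.hom x) :=
    bmap_bt (k := k) f.hom d x
  have h2 := smul_bt (k := k) c d (1 : R) (f.hom x)
  rw [one_smul] at h2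
  rw [h1]
  exact h2

lemma B_map_smul {X N : ModuleCat.{0} R} (a : k) (f : X ⟶ N) :
    (B k k' R).map (a • f) = algebraMap k k' a • (B k k' R).map f := by
  refine ModuleCat.hom_ext (bhom_ext (X := X) (Y := Bc k k' N) (fun x => ?_))
  refine (bmap_bt (k := k) (a • f).hom (1 : k') x).trans ?_
  refine Eq.trans ?_ (B_smul_map k k' (algebraMap k k' a) 1 f x).symm
  rw [mul_one]
  change ((1 : k') ⊗ₜ[k] (a • f.hom x) : k' ⊗[k] N) = _
  rw [← TensorProduct.smul_tmul, Algebra.smul_def, mul_one]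
  rfl

def phiAux : k' ⊗[k] (X ⟶ N) →+ ((B k k' R).obj X ⟶ (B k k' R).obj N) :=
  TensorProduct.liftAddHom (R := k) (M := k') (N := (X ⟶ N))
    (AddMonoidHom.mk' (fun c => AddMonoidHom.mk' (fun f => c • (B k k' R).map f)
      (by intro a b; rw [Functor.map_add, smul_add])) (by
        intro a b; ext1 x; exact add_smul _ _ _))
    (by
      intro a c f
      simp only [AddMonoidHom.mk'_apply]
      rw [B_map_smul, Algebra.smul_def, mul_comm, mul_smul])

def phi : k' ⊗[k] (X ⟶ N) →ₗ[k'] ((B k k' R).obj X ⟶ (B k k' R).obj N) :=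
  { phiAux k k' N X with
    map_smul' := by
      intro c t
      change phiAux k k' N X (c • t) = c • phiAux k k' N X t
      induction t using TensorProduct.induction_on with
      | zero => rw [smul_zero, map_zero, smul_zero]
      | add s t hs ht => rw [smul_add, map_add, map_add, smul_add, hs, ht]
      | tmul d f =>
        rw [TensorProduct.smul_tmul']
        exact mul_smul c d ((B k k' R).map f) }

lemma phi_tmul (c : k') (f : X ⟶ N) :
    phi k k' N X (c ⊗ₜ f) = c • (B k k' R).map f := rfl

variable {X} in
lemma phi_natural {X' : ModuleCat.{0} R} (g : X' ⟶ X) (t : k' ⊗[k] (X ⟶ N)) :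
    phi k k' N X' (LinearMap.lTensor k' (Linear.leftComp k N g) t) =
      (B k k' R).map g ≫ phi k k' N X t := by
  induction t using TensorProduct.induction_on with
  | zero => simp only [map_zero, Limits.comp_zero]
  | add s t hs ht => simp only [map_add, Preadditive.comp_add, hs, ht]
  | tmul d f =>
    rw [LinearMap.lTensor_tmul, phi_tmul, phi_tmul, Linear.leftComp_apply, Functor.map_comp,
      Linear.comp_smul]

variable {X} in
def evB {ι : Type} (b : Module.Basis ι R X) :
    ((B k k' R).obj X ⟶ (B k k' R).obj N) →+ (ι → k' ⊗[k] N) :=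
  AddMonoidHom.mk' (fun f i => f.hom (bt k' 1 (b i))) (fun _ _ => rfl)

lemma evB_inj {ι : Type} (b : Module.Basis ι R X) : Function.Injective (evB k k' N b) := by
  rw [injective_iff_map_eq_zero]
  intro f hf
  let f' : Bc k k' X →ₗ[k' ⊗[k] R] Bc k k' N := f.hom
  refine ModuleCat.hom_ext (show f' = 0 from bhom_ext (fun x => ?_))
  rw [LinearMap.zero_apply]
  induction b.mem_span x using Submodule.span_induction with
  | zero =>
    have : bt (k := k) k' 1 (0 : X) = 0 := TensorProduct.tmul_zero _ _
    rw [this, map_zero]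
  | add x y _ _ hx hy => rw [bt_add, map_add, hx, hy, add_zero]
  | smul r x _ hx =>
    have := smul_bt (k := k) (1 : k') 1 r x
    rw [mul_one] at this
    rw [← this, map_smul, hx, smul_zero]
  | mem x hx =>
    obtain ⟨i, rfl⟩ := hx
    exact congrFun hf i

def homE {ι : Type} (b : Module.Basis ι R X) : (X ⟶ N) ≃ₗ[k] (ι → N) :=
  { toFun := fun f i => f.hom (b i)
    map_add' := fun _ _ => rfl
    map_smul' := fun _ _ => rfl
    invFun := fun v => ModuleCat.ofHom (b.constr ℕ v)
    left_inv := fun f => by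
      refine ModuleCat.hom_ext (b.ext fun i => ?_)
      simp
    right_inv := fun v => by ext i; simp }

lemma evB_phi {ι : Type} [Fintype ι] [DecidableEq ι] (b : Module.Basis ι R X)
    (t : k' ⊗[k] (X ⟶ N)) :
    evB k k' N b (phi k k' N X t) =
      TensorProduct.piRight k k k' (fun _ : ι => (N : Type)) ((homE k N X b).lTensor k' t) := by
  induction t using TensorProduct.induction_on with
  | zero => simp only [map_zero]
  | add s t hs ht => simp only [map_add, hs, ht]
  | tmul d f =>
    rw [phi_tmul, LinearEquiv.lTensor_tmul, TensorProduct.piRight_apply,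
      TensorProduct.piRightHom_tmul]
    funext i
    refine (B_smul_map k k' d 1 f (b i)).trans ?_
    rw [mul_one]
    rfl

lemma phi_bij {ι : Type} [Finite ι] (b : Module.Basis ι R X) :
    Function.Bijective (phi k k' N X) := by
  classical
  have := Fintype.ofFinite ι
  have h : Function.Bijective (evB k k' N b ∘ phi k k' N X) := by
    have : evB k k' N b ∘ phi k k' N X = ((homE k N X b).lTensor k' ≪≫ₗ
      TensorProduct.piRight k k k' (fun _ : ι => (N : Type))) := by
      funext t; exact evB_phi k k' N X b t
    rw [this]
    exact LinearEquiv.bijective _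
  refine ⟨h.1.of_comp, fun f => ?_⟩
  obtain ⟨t, ht⟩ := h.2 (evB k k' N b f)
  exact ⟨t, evB_inj k k' N X b ht⟩

def phiIso {ι : Type} [Finite ι] (b : Module.Basis ι R X) :
    k' ⊗[k] (X ⟶ N) ≃ₗ[k'] ((B k k' R).obj X ⟶ (B k k' R).obj N) :=
  LinearEquiv.ofBijective (phi k k' N X) (phi_bij k k' N X b)

def cpxIso (P : ChainComplex (ModuleCat.{0} R) ℕ)
    (h : ∀ n, ∃ (ι : Type) (_ : Finite ι), Nonempty (Module.Basis ι R (P.X n))) :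
    ((T k k').mapHomologicalComplex _).obj (P.linearYonedaObj k N) ≅
      ChainComplex.linearYonedaObj (((B k k' R).mapHomologicalComplex _).obj P)
        k' ((B k k' R).obj N) :=
  HomologicalComplex.Hom.isoOfComponents
    (fun n => (LinearEquiv.ofBijective (phi k k' N (P.X n)) (by
      obtain ⟨ι, _, ⟨b⟩⟩ := h n
      exact phi_bij k k' N (P.X n) b)).toModuleIso)
    (fun i j _ => ModuleCat.hom_ext (LinearMap.ext fun t =>
      (phi_natural k k' N (P.d j i) t).symm))

def mapHomIso (K : CochainComplex (ModuleCat.{0} k) ℕ) (n : ℕ) :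
    (((T k k').mapHomologicalComplex _).obj K).homology n ≅ (T k k').obj (K.homology n) :=
  (K.sc n).mapHomologyIso (T k k')


variable (M : Type) [AddCommGroup M] [Module R M] [Module k M] [IsScalarTower k R M]

variable {M} in
/-- comparison between two `k`-structures -/
def kEquiv {X : ModuleCat.{0} R} (e : M ≃ₗ[R] X) : M ≃ₗ[k] X :=
  e.restrictScalars k

def objEquiv {X : ModuleCat.{0} R} (e₀ : M ≃ₗ[R] X) [Module (k' ⊗[k] R) (k' ⊗[k] M)]
    (hsmulM : ∀ (c : k') (r : R) (d : k') (m : M),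
      ((c ⊗ₜ[k] r : k' ⊗[k] R)) • ((d ⊗ₜ[k] m : k' ⊗[k] M)) = (c * d) ⊗ₜ[k] (r • m)) :
    (k' ⊗[k] M) ≃ₗ[k' ⊗[k] R] (B k k' R).obj X :=
  { ((kEquiv k e₀).lTensor k').toAddEquiv with
    map_smul' := by
      let e : (k' ⊗[k] M) →+ Bc k k' X :=
        ((kEquiv k e₀).lTensor k').toAddEquiv.toAddMonoidHom
      intro s x
      change e (s • x) = s • e x
      induction s using TensorProduct.induction_on with
      | zero => rw [zero_smul, zero_smul, map_zero]
      | add s t hs ht => rw [add_smul, add_smul, map_add, hs, ht]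
      | tmul c r =>
        induction x using TensorProduct.induction_on with
        | zero => rw [smul_zero, map_zero, smul_zero]
        | add x y hx hy => rw [smul_add, map_add, map_add, smul_add, hx, hy]
        | tmul d m =>
          rw [hsmulM]
          refine Eq.trans ?_ (smul_bt (k := k) c d r (e₀ m)).symm
          rw [← map_smul]
          rfl }

def extIso [IsNoetherianRing R] (X Y : ModuleCat.{0} R) [Module.Finite R X] (i : ℕ) :
    ((Ext k' (ModuleCat.{0} (k' ⊗[k] R)) i).obj (Opposite.op ((B k k' R).obj X))).obj
      ((B k k' R).obj Y) ≅
    (T k k').obj (((Ext k (ModuleCat.{0} R) i).obj (Opposite.op X)).obj Y) :=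
  ((B k k' R).mapProjectiveResolution (res X)).isoExt i ((B k k' R).obj Y) ≪≫
    (HomologicalComplex.homologyFunctor _ _ i).mapIso
      (cpxIso k k' Y (res X).complex (cpx_basis X)).symm ≪≫
    mapHomIso k k' ((res X).complex.linearYonedaObj k Y) i ≪≫
    (T k k').mapIso ((res X).isoExt i Y).symm

end BC
end
end ExtBC

/-- Let `k` be a field, `R` a (possibly noncommutative) noetherian
`k`-algebra, `M`, `N` finitely generated `R`-modules and `k'` a field extension of `k`.
Then for every `i ≥ 0` there is an isomorphism of `k'`-vector spaces
`Ext^i_{R ⊗_k k'}(M ⊗_k k', N ⊗_k k') ≃ Ext^i_R(M, N) ⊗_k k'`.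
(The base change `k' ⊗[k] M` carries its canonical `k' ⊗[k] R`-module structure, which is
pinned down on pure tensors by the hypotheses `hsmulM`, `hsmulN`.) -/
theorem ext_baseChange_iso
    (k : Type) [Field k] (k' : Type) [Field k'] [Algebra k k']
    (R : Type) [Ring R] [Algebra k R] [IsNoetherianRing R]
    (M N : Type) [AddCommGroup M] [Module R M] [Module k M] [IsScalarTower k R M]
    [AddCommGroup N] [Module R N] [Module k N] [IsScalarTower k R N]
    [Module.Finite R M] [Module.Finite R N]
    [Module (k' ⊗[k] R) (k' ⊗[k] M)] [Module (k' ⊗[k] R) (k' ⊗[k] N)]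
    (hsmulM : ∀ (c : k') (r : R) (d : k') (m : M),
      ((c ⊗ₜ[k] r : k' ⊗[k] R)) • ((d ⊗ₜ[k] m : k' ⊗[k] M)) = (c * d) ⊗ₜ[k] (r • m))
    (hsmulN : ∀ (c : k') (r : R) (d : k') (n : N),
      ((c ⊗ₜ[k] r : k' ⊗[k] R)) • ((d ⊗ₜ[k] n : k' ⊗[k] N)) = (c * d) ⊗ₜ[k] (r • n))
    (i : ℕ) :
    Nonempty
      ((((Ext k' (ModuleCat (k' ⊗[k] R)) i).obj
          (Opposite.op (ModuleCat.of (k' ⊗[k] R) (k' ⊗[k] M)))).obj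
            (ModuleCat.of (k' ⊗[k] R) (k' ⊗[k] N))) ≃ₗ[k']
        (k' ⊗[k] (((Ext k (ModuleCat R) i).obj
          (Opposite.op (ModuleCat.of R M))).obj (ModuleCat.of R N)))) := by
  exact ⟨(((Ext k' (ModuleCat (k' ⊗[k] R)) i).mapIso
      (ExtBC.objEquiv k k' M (X := ModuleCat.of R M) (LinearEquiv.refl R M) hsmulM).toModuleIso.symm.op).app _ ≪≫
    ((Ext k' (ModuleCat (k' ⊗[k] R)) i).obj _).mapIso
      (ExtBC.objEquiv k k' N (X := ModuleCat.of R N) (LinearEquiv.refl R N) hsmulN).toModuleIso ≪≫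
    ExtBC.extIso k k' (ModuleCat.of R M) (ModuleCat.of R N) i).toLinearEquiv⟩
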